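/- arXiv:1401.3700 — 5 statements merged into one kernel-verified Lean document; each statement's English description precedes it below -/
import Mathlib

section
/- Define the affine map 𝒜 from real symmetric 4×4 matrices V = (V_{ij})_{1≤i,j≤4} to 3×3 matrices by: 𝒜(V)₁₁ = 2(V₁₁ + V₂₂) − 1, 𝒜(V)₁₂ = 2(V₂₃ − V₁₄), 𝒜(V)₁₃ = 2(V₂₄ + V₁₃), 𝒜(V)₂₁ = 2(V₂₃ + V₁₄), 𝒜(V)₂₂ = 2(V₁₁ + V₃₃) − 1, 𝒜(V)₂₃ = 2(V₃₄ − V₁₂), 𝒜(V)₃₁ = 2(V₂₄ − V₁₃), 𝒜(V)₃₂ = 2(V₃₄ + V₁₂), 𝒜(V)₃₃ = 2(V₁₁ + V₄₄) − 1. Then a 3×3 real matrix X lies in conv(SO(3)) if and only if there exists a real symmetric 4×4 positive semidefinite matrix V with trace V = 1 such that X = 𝒜(V). -/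
open Matrix

/-- The affine map 𝒜 from 4×4 symmetric matrices to 3×3 matrices
(indices here are 0-based; `V i j` corresponds to `V_{(i+1)(j+1)}`). -/
noncomputable def affineA (V : Matrix (Fin 4) (Fin 4) ℝ) : Matrix (Fin 3) (Fin 3) ℝ :=
  !![2 * (V 0 0 + V 1 1) - 1, 2 * (V 1 2 - V 0 3),     2 * (V 1 3 + V 0 2);
     2 * (V 1 2 + V 0 3),     2 * (V 0 0 + V 2 2) - 1, 2 * (V 2 3 - V 0 1);
     2 * (V 1 3 - V 0 2),     2 * (V 2 3 + V 0 1),     2 * (V 0 0 + V 3 3) - 1]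

/-- The candidate preimage under the affine map. -/
noncomputable def preV (R : Matrix (Fin 3) (Fin 3) ℝ) : Matrix (Fin 4) (Fin 4) ℝ :=
  !![(1 + R 0 0 + R 1 1 + R 2 2) / 4, (R 2 1 - R 1 2) / 4, (R 0 2 - R 2 0) / 4, (R 1 0 - R 0 1) / 4;
     (R 2 1 - R 1 2) / 4, (1 + R 0 0 - R 1 1 - R 2 2) / 4, (R 0 1 + R 1 0) / 4, (R 0 2 + R 2 0) / 4;
     (R 0 2 - R 2 0) / 4, (R 0 1 + R 1 0) / 4, (1 - R 0 0 + R 1 1 - R 2 2) / 4, (R 1 2 + R 2 1) / 4;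
     (R 1 0 - R 0 1) / 4, (R 0 2 + R 2 0) / 4, (R 1 2 + R 2 1) / 4, (1 - R 0 0 - R 1 1 + R 2 2) / 4]

lemma preV_symm (R : Matrix (Fin 3) (Fin 3) ℝ) : (preV R)ᵀ = preV R := by
  ext i j
  fin_cases i <;> fin_cases j <;> simp [preV]

lemma preV_idem (R : Matrix (Fin 3) (Fin 3) ℝ) (h : Rᵀ * R = 1) (hd : R.det = 1) :
    preV R * preV R = preV R := by
  have h' : R * Rᵀ = 1 := mul_eq_one_comm.mp h
  have ha : R.adjugate = Rᵀ := by
    calc R.adjugate = (Rᵀ * R) * R.adjugate := by rw [h, one_mul]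
      _ = Rᵀ := by rw [mul_assoc, mul_adjugate, hd, one_smul, mul_one]
  have e1 := fun i j => congrFun (congrFun h i) j
  have e2 := fun i j => congrFun (congrFun h' i) j
  have e3 := fun i j => congrFun (congrFun ha i) j
  rw [adjugate_fin_three] at e3
  simp [Matrix.mul_apply, Fin.sum_univ_three, Fin.forall_fin_succ, Matrix.one_apply] at e1 e2 e3
  obtain ⟨⟨a1, a2, a3⟩, ⟨a4, a5, a6⟩, a7, a8, a9⟩ := e1
  obtain ⟨⟨b1, b2, b3⟩, ⟨b4, b5, b6⟩, b7, b8, b9⟩ := e2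
  obtain ⟨⟨c1, c2, c3⟩, ⟨c4, c5, c6⟩, c7, c8, c9⟩ := e3
  ext i j
  fin_cases i <;> fin_cases j <;>
    simp [preV, Matrix.mul_apply, Fin.sum_univ_four] <;> linarith

lemma preV_affineA (R : Matrix (Fin 3) (Fin 3) ℝ) : affineA (preV R) = R := by
  ext i j
  fin_cases i <;> fin_cases j <;> simp [preV, affineA] <;> ring

lemma preV_trace (R : Matrix (Fin 3) (Fin 3) ℝ) : (preV R).trace = 1 := by
  simp [preV, Matrix.trace, Fin.sum_univ_four]; ring

/-- The homogeneous quaternion-to-matrix map. -/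
def quatM (b : Fin 4 → ℝ) : Matrix (Fin 3) (Fin 3) ℝ :=
  !![b 0^2 + b 1^2 - b 2^2 - b 3^2, 2 * (b 1 * b 2 - b 0 * b 3), 2 * (b 1 * b 3 + b 0 * b 2);
     2 * (b 1 * b 2 + b 0 * b 3), b 0^2 + b 2^2 - b 1^2 - b 3^2, 2 * (b 2 * b 3 - b 0 * b 1);
     2 * (b 1 * b 3 - b 0 * b 2), 2 * (b 2 * b 3 + b 0 * b 1), b 0^2 + b 3^2 - b 1^2 - b 2^2]

lemma quatM_unit (b : Fin 4 → ℝ) (h : b 0^2 + b 1^2 + b 2^2 + b 3^2 = 1) :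
    (quatM b)ᵀ * quatM b = 1 ∧ (quatM b).det = 1 := by
  constructor
  · have key : (quatM b)ᵀ * quatM b = ((b 0^2 + b 1^2 + b 2^2 + b 3^2)^2) • 1 := by
      ext i j
      fin_cases i <;> fin_cases j <;>
        simp [quatM, Matrix.mul_apply, Fin.sum_univ_three] <;> ring
    rw [key, h]; simp
  · have key : (quatM b).det = (b 0^2 + b 1^2 + b 2^2 + b 3^2)^3 := by
      rw [Matrix.det_fin_three]; simp [quatM]; ring
    rw [key, h]; simp

lemma quatM_eq (b : Fin 4 → ℝ) :
    ∃ R : Matrix (Fin 3) (Fin 3) ℝ, (Rᵀ * R = 1 ∧ R.det = 1) ∧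
      quatM b = (b 0^2 + b 1^2 + b 2^2 + b 3^2) • R := by
  by_cases h : b 0^2 + b 1^2 + b 2^2 + b 3^2 = 0
  · refine ⟨1, by simp, ?_⟩
    have h0 : b 0 = 0 := by nlinarith [sq_nonneg (b 0), sq_nonneg (b 1), sq_nonneg (b 2), sq_nonneg (b 3)]
    have h1 : b 1 = 0 := by nlinarith [sq_nonneg (b 0), sq_nonneg (b 1), sq_nonneg (b 2), sq_nonneg (b 3)]
    have h2 : b 2 = 0 := by nlinarith [sq_nonneg (b 0), sq_nonneg (b 1), sq_nonneg (b 2), sq_nonneg (b 3)]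
    have h3 : b 3 = 0 := by nlinarith [sq_nonneg (b 0), sq_nonneg (b 1), sq_nonneg (b 2), sq_nonneg (b 3)]
    ext i j
    fin_cases i <;> fin_cases j <;> simp [quatM, h0, h1, h2, h3]
  · set w := b 0^2 + b 1^2 + b 2^2 + b 3^2 with hw
    have hwp : 0 < w := lt_of_le_of_ne (by positivity) (Ne.symm h)
    have hs : (√w)^2 = w := Real.sq_sqrt hwp.le
    have hsc : ∀ i j, (b i / √w) * (b j / √w) = b i * b j / w := fun i j => by
      rw [div_mul_div_comm, ← sq, hs]
    have hsq : ∀ i, (b i / √w)^2 = b i ^2 / w := fun i => by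
      rw [div_pow, hs]
    refine ⟨quatM (fun i => b i / √w), quatM_unit _ ?_, ?_⟩
    · simp only [hsq]
      rw [← add_div, ← add_div, ← add_div, ← hw, div_self h]
    · ext i j
      fin_cases i <;> fin_cases j <;> simp [quatM, hsq, hsc] <;> field_simp

/-- X ∈ conv(SO(3)) iff X = 𝒜(V) for some symmetric PSD V with
trace V = 1. -/
theorem convexHull_so3_eq_affine_image (X : Matrix (Fin 3) (Fin 3) ℝ) :
    X ∈ convexHull ℝ {R : Matrix (Fin 3) (Fin 3) ℝ | Rᵀ * R = 1 ∧ R.det = 1} ↔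
      ∃ V : Matrix (Fin 4) (Fin 4) ℝ,
        Vᵀ = V ∧ V.PosSemidef ∧ V.trace = 1 ∧ X = affineA V := by
  constructor
  · intro hX
    have hsub : convexHull ℝ {R : Matrix (Fin 3) (Fin 3) ℝ | Rᵀ * R = 1 ∧ R.det = 1} ⊆
        {X | ∃ V : Matrix (Fin 4) (Fin 4) ℝ,
          Vᵀ = V ∧ V.PosSemidef ∧ V.trace = 1 ∧ X = affineA V} := by
      apply convexHull_min
      · rintro R ⟨h, hd⟩
        refine ⟨preV R, preV_symm R, ?_, preV_trace R, (preV_affineA R).symm⟩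
        have := posSemidef_conjTranspose_mul_self (preV R)
        rwa [conjTranspose_eq_transpose_of_trivial, preV_symm, preV_idem R h hd] at this
      · rintro _ ⟨V, hV, pV, tV, rfl⟩ _ ⟨W, hW, pW, tW, rfl⟩ a b ha hb hab
        refine ⟨a • V + b • W, by simp [hV, hW], (pV.smul ha).add (pW.smul hb),
          by simp [tV, tW, hab], ?_⟩
        obtain rfl : b = 1 - a := by linarith
        ext i j
        fin_cases i <;> fin_cases j <;> simp [affineA] <;> ring
    exact hsub hX
  · rintro ⟨V, -, pV, tV, rfl⟩
    obtain ⟨B, rfl⟩ : ∃ B : Matrix (Fin 4) (Fin 4) ℝ, V = Bᴴ * B := by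
      open scoped MatrixOrder Matrix.Norms.L2Operator in
      exact CStarAlgebra.nonneg_iff_eq_star_mul_self.mp pV.nonneg
    choose R hR hQ using fun k => quatM_eq (B k)
    simp [Matrix.trace, Matrix.mul_apply, Fin.sum_univ_four] at tV
    have key : affineA (Bᴴ * B) =
        ∑ k, (B k 0^2 + B k 1^2 + B k 2^2 + B k 3^2) • R k := by
      simp only [← hQ]
      ext i j
      fin_cases i <;> fin_cases j <;>
        simp [affineA, quatM, Matrix.mul_apply, Fin.sum_univ_four] <;> linarith
    rw [key]
    refine (convex_convexHull ℝ _).sum_mem (fun k _ => by positivity) ?_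
      (fun k _ => subset_convexHull ℝ _ (hR k))
    simp only [Fin.sum_univ_four]
    linarith
end

section
/- A 3×3 real matrix X = (x_{ij}) lies in conv(SO(3)) if and only if the symmetric 4×4 matrix with rows (1 + x₁₁ + x₂₂ + x₃₃, x₃₂ − x₂₃, x₁₃ − x₃₁, x₂₁ − x₁₂); (x₃₂ − x₂₃, 1 + x₁₁ − x₂₂ − x₃₃, x₂₁ + x₁₂, x₁₃ + x₃₁); (x₁₃ − x₃₁, x₂₁ + x₁₂, 1 − x₁₁ + x₂₂ − x₃₃, x₃₂ + x₂₃); (x₂₁ − x₁₂, x₁₃ + x₃₁, x₃₂ + x₂₃, 1 − x₁₁ − x₂₂ + x₃₃) is positive semidefinite. In particular, conv(SO(3)) is a spectrahedron. -/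
open Matrix

def so3A (X : Matrix (Fin 3) (Fin 3) ℝ) : Matrix (Fin 4) (Fin 4) ℝ :=
  !![1 + X 0 0 + X 1 1 + X 2 2, X 2 1 - X 1 2, X 0 2 - X 2 0, X 1 0 - X 0 1;
          X 2 1 - X 1 2, 1 + X 0 0 - X 1 1 - X 2 2, X 1 0 + X 0 1, X 0 2 + X 2 0;
          X 0 2 - X 2 0, X 1 0 + X 0 1, 1 - X 0 0 + X 1 1 - X 2 2, X 2 1 + X 1 2;
          X 1 0 - X 0 1, X 0 2 + X 2 0, X 2 1 + X 1 2,
            1 - X 0 0 - X 1 1 + X 2 2]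

/-- The homogeneous quadratic quaternion map. -/
def so3Q (q : Fin 4 → ℝ) : Matrix (Fin 3) (Fin 3) ℝ :=
  !![q 0 ^ 2 + q 1 ^ 2 - q 2 ^ 2 - q 3 ^ 2, 2 * (q 1 * q 2 - q 0 * q 3), 2 * (q 1 * q 3 + q 0 * q 2);
     2 * (q 1 * q 2 + q 0 * q 3), q 0 ^ 2 - q 1 ^ 2 + q 2 ^ 2 - q 3 ^ 2, 2 * (q 2 * q 3 - q 0 * q 1);
     2 * (q 1 * q 3 - q 0 * q 2), 2 * (q 2 * q 3 + q 0 * q 1), q 0 ^ 2 - q 1 ^ 2 - q 2 ^ 2 + q 3 ^ 2]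

def so3N (q : Fin 4 → ℝ) : ℝ := q 0 ^ 2 + q 1 ^ 2 + q 2 ^ 2 + q 3 ^ 2

lemma so3Q_mul (q : Fin 4 → ℝ) : (so3Q q)ᵀ * so3Q q = (so3N q) ^ 2 • 1 := by
  ext i j
  fin_cases i <;> fin_cases j <;>
    simp [so3Q, so3N, Matrix.mul_apply, Fin.sum_univ_three] <;> ring

lemma so3Q_det (q : Fin 4 → ℝ) : (so3Q q).det = (so3N q) ^ 3 := by
  rw [Matrix.det_fin_three]
  simp [so3Q, so3N]
  ring

lemma so3N_nonneg (q : Fin 4 → ℝ) : 0 ≤ so3N q := by unfold so3N; positivity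

lemma so3_exists (q : Fin 4 → ℝ) : ∃ R : Matrix (Fin 3) (Fin 3) ℝ,
    (Rᵀ * R = 1 ∧ R.det = 1) ∧ so3Q q = so3N q • R := by
  by_cases h : so3N q = 0
  · refine ⟨1, by simp, ?_⟩
    have h' := h
    unfold so3N at h'
    have h0 : q 0 = 0 := by nlinarith [sq_nonneg (q 0), sq_nonneg (q 1), sq_nonneg (q 2), sq_nonneg (q 3)]
    have h1 : q 1 = 0 := by nlinarith [sq_nonneg (q 0), sq_nonneg (q 1), sq_nonneg (q 2), sq_nonneg (q 3)]
    have h2 : q 2 = 0 := by nlinarith [sq_nonneg (q 0), sq_nonneg (q 1), sq_nonneg (q 2), sq_nonneg (q 3)]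
    have h3 : q 3 = 0 := by nlinarith [sq_nonneg (q 0), sq_nonneg (q 1), sq_nonneg (q 2), sq_nonneg (q 3)]
    rw [h, zero_smul]
    ext i j
    fin_cases i <;> fin_cases j <;> simp [so3Q, h0, h1, h2, h3]
  · refine ⟨(so3N q)⁻¹ • so3Q q, ⟨?_, ?_⟩, ?_⟩
    · rw [Matrix.transpose_smul, Matrix.smul_mul, Matrix.mul_smul, so3Q_mul, smul_smul, smul_smul]
      rw [show (so3N q)⁻¹ * (so3N q)⁻¹ * so3N q ^ 2 = 1 by field_simp, one_smul]
    · rw [Matrix.det_smul, so3Q_det]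
      simp
      field_simp
    · rw [smul_smul, mul_inv_cancel₀ h, one_smul]

lemma so3A_sq (R : Matrix (Fin 3) (Fin 3) ℝ) (h : Rᵀ * R = 1) (hd : R.det = 1) :
    so3A R * (so3A R)ᵀ = (4 : ℝ) • so3A R := by
  have h' : R * Rᵀ = 1 := mul_eq_one_comm.mp h
  have hadj : R.adjugate = Rᵀ := by
    calc R.adjugate = (Rᵀ * R) * R.adjugate := by rw [h, one_mul]
      _ = Rᵀ := by rw [mul_assoc, Matrix.mul_adjugate, hd, one_smul, mul_one]
  have e1 := fun i j => congrFun (congrFun h i) j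
  have e2 := fun i j => congrFun (congrFun h' i) j
  have e3 := fun i j => congrFun (congrFun hadj i) j
  rw [Matrix.adjugate_fin_three] at e3
  simp [Fin.forall_fin_succ, Matrix.mul_apply, Fin.sum_univ_three] at e1 e2 e3
  obtain ⟨⟨a1, a2, a3⟩, ⟨a4, a5, a6⟩, a7, a8, a9⟩ := e1
  obtain ⟨⟨b1, b2, b3⟩, ⟨b4, b5, b6⟩, b7, b8, b9⟩ := e2
  obtain ⟨⟨c1, c2, c3⟩, ⟨c4, c5, c6⟩, c7, c8, c9⟩ := e3
  clear h hd h' hadj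
  ext i j
  fin_cases i <;> fin_cases j <;>
    simp [so3A, Matrix.mul_apply, Fin.sum_univ_four] <;> linarith

lemma so3A_posSemidef (R : Matrix (Fin 3) (Fin 3) ℝ) (h : Rᵀ * R = 1) (hd : R.det = 1) :
    (so3A R).PosSemidef := by
  have h1 : so3A R = (1 / 4 : ℝ) • (so3A R * (so3A R)ᴴ) := by
    rw [Matrix.conjTranspose_eq_transpose_of_trivial, so3A_sq R h hd, smul_smul]
    norm_num
  rw [h1]
  exact (Matrix.posSemidef_self_mul_conjTranspose _).smul (by norm_num)

lemma so3A_convex : Convex ℝ {X : Matrix (Fin 3) (Fin 3) ℝ | (so3A X).PosSemidef} := by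
  intro X hX Y hY a b ha hb hab
  have : so3A (a • X + b • Y) = a • so3A X + b • so3A Y := by
    have hb' : b = 1 - a := by linarith
    subst hb'
    ext i j
    fin_cases i <;> fin_cases j <;> simp [so3A] <;> ring
  simp only [Set.mem_ofPred_eq] at *
  rw [this]
  exact (hX.smul ha).add (hY.smul hb)

lemma so3_back (X : Matrix (Fin 3) (Fin 3) ℝ) (h : (so3A X).PosSemidef) :
    X ∈ convexHull ℝ {R : Matrix (Fin 3) (Fin 3) ℝ | Rᵀ * R = 1 ∧ R.det = 1} := by
  obtain ⟨m, v, hv⟩ := Matrix.posSemidef_iff_eq_sum_vecMulVec.mp h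
  choose R hR hQ using so3_exists
  have e : ∀ i j, so3A X i j = ∑ k, v k i * v k j := by
    intro i j
    rw [hv, Matrix.sum_apply]
    simp [Matrix.vecMulVec_apply]
  have hw : ∑ k, so3N (v k) / 4 = 1 := by
    have : ∑ k, so3N (v k) / 4 = (so3A X 0 0 + so3A X 1 1 + so3A X 2 2 + so3A X 3 3) / 4 := by
      simp only [e, ← Finset.sum_add_distrib, Finset.sum_div]
      exact Finset.sum_congr rfl fun k _ => by unfold so3N; ring
    rw [this]
    simp [so3A]
    ring
  have hX : X = ∑ k, (so3N (v k) / 4) • R (v k) := by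
    have h1 : ∀ k, (so3N (v k) / 4) • R (v k) = (1 / 4 : ℝ) • so3Q (v k) := by
      intro k
      rw [hQ, smul_smul]
      congr 1
      ring
    simp only [h1]
    have key : X = (1 / 4 : ℝ) • 
      !![so3A X 0 0 + so3A X 1 1 - so3A X 2 2 - so3A X 3 3, 2 * (so3A X 1 2 - so3A X 0 3), 2 * (so3A X 1 3 + so3A X 0 2);
         2 * (so3A X 1 2 + so3A X 0 3), so3A X 0 0 - so3A X 1 1 + so3A X 2 2 - so3A X 3 3, 2 * (so3A X 2 3 - so3A X 0 1);
         2 * (so3A X 1 3 - so3A X 0 2), 2 * (so3A X 2 3 + so3A X 0 1), so3A X 0 0 - so3A X 1 1 - so3A X 2 2 + so3A X 3 3] := by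
      ext i j
      fin_cases i <;> fin_cases j <;> simp [so3A] <;> ring
    rw [← Finset.smul_sum]
    refine key.trans ?_
    congr 1
    simp only [e]
    ext i j
    rw [Matrix.sum_apply]
    fin_cases i <;> fin_cases j <;>
      simp [so3Q, pow_two, Finset.sum_add_distrib, Finset.sum_sub_distrib, ← Finset.mul_sum]
  rw [hX]
  exact (convex_convexHull ℝ _).sum_mem (fun k _ => div_nonneg (so3N_nonneg _) (by norm_num)) hw
    (fun k _ => subset_convexHull ℝ _ (hR _))



/-- X ∈ conv(SO(3)) iff the displayed symmetric 4×4 matrix is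
positive semidefinite.  (Indices here are 0-based; `X i j` corresponds to
`x_{(i+1)(j+1)}`.)  In particular conv(SO(3)) is a spectrahedron. -/
theorem convexHull_so3_spectrahedron (X : Matrix (Fin 3) (Fin 3) ℝ) :
    X ∈ convexHull ℝ {R : Matrix (Fin 3) (Fin 3) ℝ | Rᵀ * R = 1 ∧ R.det = 1} ↔
      (!![1 + X 0 0 + X 1 1 + X 2 2, X 2 1 - X 1 2, X 0 2 - X 2 0, X 1 0 - X 0 1;
          X 2 1 - X 1 2, 1 + X 0 0 - X 1 1 - X 2 2, X 1 0 + X 0 1, X 0 2 + X 2 0;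
          X 0 2 - X 2 0, X 1 0 + X 0 1, 1 - X 0 0 + X 1 1 - X 2 2, X 2 1 + X 1 2;
          X 1 0 - X 0 1, X 0 2 + X 2 0, X 2 1 + X 1 2,
            1 - X 0 0 - X 1 1 + X 2 2]).PosSemidef := by

  constructor
  · intro h
    exact convexHull_min (fun R hR => so3A_posSemidef R hR.1 hR.2) so3A_convex h
  · exact so3_back X
end

section
/- For n = 2 and n = 3, the set of extreme points of conv(SO(n)) is exactly SO(n). That is, every R ∈ SO(n) is an extreme point of conv(SO(n)), and every extreme point of conv(SO(n)) belongs to SO(n). -/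
open Matrix

/-- The parallelogram-type identity for the squared Frobenius norm. -/
lemma frob_identity {n : ℕ} (a b : Matrix (Fin n) (Fin n) ℝ) (s t : ℝ) (h : s + t = 1) :
    ∑ i, ∑ j, (s • a + t • b) i j ^ 2 =
      s * ∑ i, ∑ j, a i j ^ 2 + t * ∑ i, ∑ j, b i j ^ 2
        - s * t * ∑ i, ∑ j, (a i j - b i j) ^ 2 := by
  simp only [Finset.mul_sum, ← Finset.sum_add_distrib, ← Finset.sum_sub_distrib]
  refine Finset.sum_congr rfl fun i _ => Finset.sum_congr rfl fun j _ => ?_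
  obtain rfl : t = 1 - s := by linarith
  simp only [Matrix.add_apply, Matrix.smul_apply, smul_eq_mul]
  ring

lemma frob_so {n : ℕ} (R : Matrix (Fin n) (Fin n) ℝ) (h : Rᵀ * R = 1) :
    ∑ i, ∑ j, R i j ^ 2 = n := by
  have h1 : (Rᵀ * R).trace = n := by rw [h]; simp
  rw [← h1, Finset.sum_comm]
  simp only [Matrix.trace, Matrix.diag, Matrix.mul_apply, Matrix.transpose_apply, pow_two]

lemma frob_hull {n : ℕ} (x : Matrix (Fin n) (Fin n) ℝ)
    (hx : x ∈ convexHull ℝ {R : Matrix (Fin n) (Fin n) ℝ | Rᵀ * R = 1 ∧ R.det = 1}) :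
    ∑ i, ∑ j, x i j ^ 2 ≤ n := by
  have hc : Convex ℝ {x : Matrix (Fin n) (Fin n) ℝ | ∑ i, ∑ j, x i j ^ 2 ≤ n} := by
    intro a ha b hb s t hs ht hst
    simp only [Set.mem_setOf_eq] at ha hb ⊢
    rw [frob_identity a b s t hst]
    have h0 : 0 ≤ s * t * ∑ i, ∑ j, (a i j - b i j) ^ 2 := by positivity
    have h1 := mul_le_mul_of_nonneg_left ha hs
    have h2 := mul_le_mul_of_nonneg_left hb ht
    have h3 : s * (n : ℝ) + t * n = n := by rw [← add_mul, hst, one_mul]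
    linarith
  exact convexHull_min (fun R hR => (frob_so R hR.1).le) hc hx

/-- for n = 2 and n = 3, the extreme points of conv(SO(n)) are
exactly SO(n). -/
theorem extremePoints_convexHull_so (n : ℕ) (hn : n = 2 ∨ n = 3) :
    Set.extremePoints ℝ
        (convexHull ℝ {R : Matrix (Fin n) (Fin n) ℝ | Rᵀ * R = 1 ∧ R.det = 1}) =
      {R : Matrix (Fin n) (Fin n) ℝ | Rᵀ * R = 1 ∧ R.det = 1} := by
  refine Set.Subset.antisymm extremePoints_convexHull_subset fun x hx => ?_
  rw [mem_extremePoints_iff_left]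
  refine ⟨subset_convexHull ℝ _ hx, fun a ha b hb hab => ?_⟩
  obtain ⟨s, t, hs, ht, hst, rfl⟩ := hab
  have hq := frob_so _ hx.1
  rw [frob_identity a b s t hst] at hq
  have h1 := mul_le_mul_of_nonneg_left (frob_hull a ha) hs.le
  have h2 := mul_le_mul_of_nonneg_left (frob_hull b hb) ht.le
  have h3 : s * (n : ℝ) + t * n = n := by rw [← add_mul, hst, one_mul]
  have h4 : s * t * ∑ i, ∑ j, (a i j - b i j) ^ 2 ≤ 0 := by linarith
  have h5 : ∑ i, ∑ j, (a i j - b i j) ^ 2 ≤ 0 :=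
    nonpos_of_mul_nonpos_right h4 (mul_pos hs ht)
  have h6 : a = b := by
    have h7 : ∑ i, ∑ j, (a i j - b i j) ^ 2 = 0 := le_antisymm h5 (by positivity)
    ext i j
    rw [Finset.sum_eq_zero_iff_of_nonneg (fun i _ => by positivity)] at h7
    have h8 := h7 i (Finset.mem_univ i)
    rw [Finset.sum_eq_zero_iff_of_nonneg (fun i _ => by positivity)] at h8
    have h9 := h8 j (Finset.mem_univ j)
    exact sub_eq_zero.mp (pow_eq_zero_iff two_ne_zero |>.mp h9)
  rw [← h6, ← add_smul, hst, one_smul]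
end

section
/- Let n ∈ {2, 3}, let P be an (n+1)×(n+1) real orthogonal matrix (PᵀP = I), let N be a positive integer, and let v₁, …, v_N and m₁, …, m_N be vectors in ℝ^{n+1}. For R an n×n real matrix, let ρ(R) denote the (n+1)×(n+1) block-diagonal matrix [[R, 0], [0, 1]]. Then: (i) there exists R* ∈ SO(n) minimizing the linear objective R ↦ −2 Σ_{i=1}^N ⟨v_i, P ρ(R) m_i⟩ over the convex set conv(SO(n)); and (ii) any such R* is a global minimizer of the (non-convex) least-squares problem: Σ_{i=1}^N ‖v_i − P ρ(R*) m_i‖₂² ≤ Σ_{i=1}^N ‖v_i − P ρ(R) m_i‖₂² for all R ∈ SO(n). -/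
open Matrix

/-- The block-diagonal embedding ρ(R) = [[R, 0], [0, 1]] of an n×n matrix into
(n+1)×(n+1) matrices. -/
def rhoEmb {n : ℕ} (R : Matrix (Fin n) (Fin n) ℝ) :
    Matrix (Fin (n + 1)) (Fin (n + 1)) ℝ :=
  Matrix.of fun i j =>
    if hi : (i : ℕ) < n then
      if hj : (j : ℕ) < n then R ⟨i, hi⟩ ⟨j, hj⟩ else 0
    else if (j : ℕ) < n then 0 else 1

theorem rhoEmb_affine {n : ℕ} (R S : Matrix (Fin n) (Fin n) ℝ) (a b : ℝ) (h : a + b = 1) :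
    rhoEmb (a • R + b • S) = a • rhoEmb R + b • rhoEmb S := by
  ext i j
  simp only [rhoEmb, Matrix.of_apply, Matrix.add_apply, Matrix.smul_apply, smul_eq_mul]
  split_ifs <;> simp [h]

theorem rhoEmb_orth {n : ℕ} (R : Matrix (Fin n) (Fin n) ℝ) (h : Rᵀ * R = 1) :
    (rhoEmb R)ᵀ * rhoEmb R = 1 := by
  ext i j
  rw [Matrix.mul_apply, Fin.sum_univ_castSucc]
  induction i using Fin.lastCases with
  | last =>
    induction j using Fin.lastCases with
    | last => simp [rhoEmb]
    | cast j =>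
      have : Fin.last n ≠ j.castSucc := (Fin.castSucc_lt_last j).ne'
      simp [rhoEmb, this]
  | cast i =>
    induction j using Fin.lastCases with
    | last =>
      have : i.castSucc ≠ Fin.last n := (Fin.castSucc_lt_last i).ne
      simp [rhoEmb, this]
    | cast j =>
      have := congrFun (congrFun h i) j
      rw [Matrix.mul_apply] at this
      simpa [rhoEmb, Matrix.one_apply] using this

theorem compact_so (n : ℕ) :
    IsCompact {R : Matrix (Fin n) (Fin n) ℝ | Rᵀ * R = 1 ∧ R.det = 1} := by
  have hK : IsCompact (Set.univ.pi fun _ : Fin n => Set.univ.pi fun _ : Fin n =>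
      Set.Icc (-1 : ℝ) 1) :=
    isCompact_univ_pi fun _ => isCompact_univ_pi fun _ => isCompact_Icc
  refine IsCompact.of_isClosed_subset (X := Matrix (Fin n) (Fin n) ℝ) hK ?_ ?_
  · exact (isClosed_eq (by fun_prop) continuous_const).inter
      (isClosed_eq (continuous_id.matrix_det) continuous_const)
  · rintro R ⟨hR, -⟩ i - j -
    have h := congrFun (congrFun hR j) j
    rw [Matrix.mul_apply, Matrix.one_apply_eq] at h
    have h2 := Finset.single_le_sum (f := fun k => Rᵀ j k * R k j)
      (fun k _ => mul_self_nonneg (R k j)) (Finset.mem_univ i)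
    rw [h] at h2
    simp only [Matrix.transpose_apply] at h2
    exact ⟨by nlinarith, by nlinarith⟩

theorem continuous_rhoEmb (n : ℕ) :
    Continuous (rhoEmb : Matrix (Fin n) (Fin n) ℝ → _) := by
  refine continuous_matrix fun i j => ?_
  simp only [rhoEmb, Matrix.of_apply]
  split_ifs <;> first | exact continuous_const | exact continuous_id.matrix_elem _ _

theorem orth_dot {k : ℕ} (Q : Matrix (Fin k) (Fin k) ℝ) (h : Qᵀ * Q = 1) (v m : Fin k → ℝ) :
    (v - Q *ᵥ m) ⬝ᵥ (v - Q *ᵥ m) = v ⬝ᵥ v + m ⬝ᵥ m + -2 * (v ⬝ᵥ (Q *ᵥ m)) := by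
  have h1 : (Q *ᵥ m) ⬝ᵥ (Q *ᵥ m) = m ⬝ᵥ m := by
    rw [Matrix.dotProduct_mulVec, ← Matrix.mulVec_transpose, Matrix.mulVec_mulVec, h,
      Matrix.one_mulVec]
  rw [sub_dotProduct, dotProduct_sub, dotProduct_sub, h1, dotProduct_comm (Q *ᵥ m) v]
  ring

/-- (i) the linear objective −2 Σᵢ ⟨vᵢ, P ρ(R) mᵢ⟩ attains its
minimum over conv(SO(n)) at some R* ∈ SO(n); (ii) any such R* globally
minimizes the least-squares objective Σᵢ ‖vᵢ − P ρ(R) mᵢ‖₂² over SO(n). -/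
theorem relaxation_exact (n : ℕ) (hn : n = 2 ∨ n = 3)
    (P : Matrix (Fin (n + 1)) (Fin (n + 1)) ℝ) (hP : Pᵀ * P = 1)
    (N : ℕ) (hN : 0 < N) (v m : Fin N → (Fin (n + 1) → ℝ)) :
    (∃ Rstar ∈ {R : Matrix (Fin n) (Fin n) ℝ | Rᵀ * R = 1 ∧ R.det = 1},
        ∀ R ∈ convexHull ℝ {R : Matrix (Fin n) (Fin n) ℝ | Rᵀ * R = 1 ∧ R.det = 1},
          -2 * ∑ i, v i ⬝ᵥ ((P * rhoEmb Rstar) *ᵥ m i) ≤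
            -2 * ∑ i, v i ⬝ᵥ ((P * rhoEmb R) *ᵥ m i)) ∧
    (∀ Rstar ∈ {R : Matrix (Fin n) (Fin n) ℝ | Rᵀ * R = 1 ∧ R.det = 1},
      (∀ R ∈ convexHull ℝ {R : Matrix (Fin n) (Fin n) ℝ | Rᵀ * R = 1 ∧ R.det = 1},
          -2 * ∑ i, v i ⬝ᵥ ((P * rhoEmb Rstar) *ᵥ m i) ≤
            -2 * ∑ i, v i ⬝ᵥ ((P * rhoEmb R) *ᵥ m i)) →
        ∀ R ∈ {R : Matrix (Fin n) (Fin n) ℝ | Rᵀ * R = 1 ∧ R.det = 1},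
          ∑ i, (v i - (P * rhoEmb Rstar) *ᵥ m i) ⬝ᵥ (v i - (P * rhoEmb Rstar) *ᵥ m i) ≤
            ∑ i, (v i - (P * rhoEmb R) *ᵥ m i) ⬝ᵥ (v i - (P * rhoEmb R) *ᵥ m i)) := by
  refine ⟨?_, ?_⟩
  · obtain ⟨R0, h0, hmin⟩ := (compact_so n).exists_isMinOn
      (f := fun R => -2 * ∑ i, v i ⬝ᵥ ((P * rhoEmb R) *ᵥ m i))
      ⟨1, by simp⟩ (by
        have := continuous_rhoEmb n
        exact Continuous.continuousOn (by fun_prop))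
    refine ⟨R0, h0, fun R hR => ?_⟩
    refine convexHull_min (t := {R | -2 * ∑ i, v i ⬝ᵥ ((P * rhoEmb R0) *ᵥ m i) ≤
            -2 * ∑ i, v i ⬝ᵥ ((P * rhoEmb R) *ᵥ m i)}) (fun S hS => hmin hS) ?_ hR
    intro A hA B hB a b ha hb hab
    simp only [Set.mem_setOf_eq] at hA hB ⊢
    have e : ∑ i, v i ⬝ᵥ ((P * rhoEmb (a • A + b • B)) *ᵥ m i) =
        a * ∑ i, v i ⬝ᵥ ((P * rhoEmb A) *ᵥ m i) + b * ∑ i, v i ⬝ᵥ ((P * rhoEmb B) *ᵥ m i) := by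
      rw [rhoEmb_affine A B a b hab, Finset.mul_sum, Finset.mul_sum, ← Finset.sum_add_distrib]
      refine Finset.sum_congr rfl fun i _ => ?_
      simp [Matrix.mul_add, Matrix.add_mulVec, Matrix.smul_mulVec]
    rw [e]
    have hb' : b = 1 - a := by linarith
    subst hb'
    nlinarith [mul_le_mul_of_nonneg_left hA ha, mul_le_mul_of_nonneg_left hB hb]
  · intro R0 h0 hmin R hR
    have key : ∀ S : Matrix (Fin n) (Fin n) ℝ, Sᵀ * S = 1 →
        ∑ i, (v i - (P * rhoEmb S) *ᵥ m i) ⬝ᵥ (v i - (P * rhoEmb S) *ᵥ m i) =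
        ∑ i, (v i ⬝ᵥ v i + m i ⬝ᵥ m i) + -2 * ∑ i, v i ⬝ᵥ ((P * rhoEmb S) *ᵥ m i) := by
      intro S hS
      rw [Finset.mul_sum, ← Finset.sum_add_distrib]
      refine Finset.sum_congr rfl fun i _ => orth_dot _ ?_ _ _
      rw [Matrix.transpose_mul, Matrix.mul_assoc, ← Matrix.mul_assoc Pᵀ, hP, Matrix.one_mul,
        rhoEmb_orth S hS]
    rw [key R0 h0.1, key R hR.1]
    linarith [hmin R (subset_convexHull ℝ _ hR)]
end

section
/- Let n be a positive integer and let S be an n×n real matrix with singular value decomposition S = U Σ Vᵀ, where U and V are n×n real orthogonal matrices (UᵀU = VᵀV = I) and Σ is a diagonal matrix with nonnegative diagonal entries. If det(U Vᵀ) = 1, then S' = U Vᵀ is a Frobenius-norm projection of S onto SO(n): S' ∈ SO(n) and ‖S' − S‖_F ≤ ‖T − S‖_F for every T ∈ SO(n). -/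
open Matrix

/-- The Frobenius norm of a real matrix: the square root of the sum of the
squares of its entries. -/
noncomputable def frobNorm {n : ℕ} (M : Matrix (Fin n) (Fin n) ℝ) : ℝ :=
  Real.sqrt (∑ i, ∑ j, (M i j) ^ 2)

lemma frob_sumsq_eq {n : ℕ} (M : Matrix (Fin n) (Fin n) ℝ) :
    ∑ i, ∑ j, (M i j) ^ 2 = (Mᵀ * M).trace := by
  rw [Finset.sum_comm]
  simp [Matrix.trace, Matrix.mul_apply, sq]

lemma frob_orth_sub {n : ℕ} (T S : Matrix (Fin n) (Fin n) ℝ) (hT : Tᵀ * T = 1) :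
    ∑ i, ∑ j, ((T - S) i j) ^ 2 = (n : ℝ) - 2 * (Tᵀ * S).trace + (Sᵀ * S).trace := by
  have h : (Sᵀ * T).trace = (Tᵀ * S).trace := by
    rw [← Matrix.trace_transpose, Matrix.transpose_mul, Matrix.transpose_transpose]
  rw [frob_sumsq_eq, Matrix.transpose_sub, Matrix.sub_mul, Matrix.mul_sub, Matrix.mul_sub, hT]
  simp only [Matrix.trace_sub, Matrix.trace_one, Fintype.card_fin, h]
  ring

lemma orth_diag_le_one {n : ℕ} (Z : Matrix (Fin n) (Fin n) ℝ) (hZ : Zᵀ * Z = 1) (i : Fin n) :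
    Z i i ≤ 1 := by
  have h : ∑ k, Z k i * Z k i = 1 := by
    have := congrFun (congrFun hZ i) i
    simpa [Matrix.mul_apply] using this
  have h2 : Z i i * Z i i ≤ ∑ k, Z k i * Z k i :=
    Finset.single_le_sum (f := fun k => Z k i * Z k i)
      (fun k _ => mul_self_nonneg _) (Finset.mem_univ i)
  nlinarith

/-- if S = U Σ Vᵀ is an SVD with det(U Vᵀ) = 1, then S' = U Vᵀ is
a Frobenius-norm projection of S onto SO(n). -/
theorem svd_projection_onto_so (n : ℕ) (hn : 0 < n)
    (S U V Sigma : Matrix (Fin n) (Fin n) ℝ)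
    (hU : Uᵀ * U = 1) (hV : Vᵀ * V = 1)
    (hSigma : ∃ d : Fin n → ℝ, (∀ i, 0 ≤ d i) ∧ Sigma = Matrix.diagonal d)
    (hSVD : S = U * Sigma * Vᵀ) (hdet : (U * Vᵀ).det = 1) :
    ((U * Vᵀ)ᵀ * (U * Vᵀ) = 1 ∧ (U * Vᵀ).det = 1) ∧
      ∀ T : Matrix (Fin n) (Fin n) ℝ, Tᵀ * T = 1 → T.det = 1 →
        frobNorm (U * Vᵀ - S) ≤ frobNorm (T - S) := by
  have hV' : V * Vᵀ = 1 := mul_eq_one_comm.mp hV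
  have hU' : U * Uᵀ = 1 := mul_eq_one_comm.mp hU
  have hO : (U * Vᵀ)ᵀ * (U * Vᵀ) = 1 := by
    rw [Matrix.transpose_mul, Matrix.transpose_transpose, Matrix.mul_assoc,
      ← Matrix.mul_assoc Uᵀ, hU, Matrix.one_mul, hV']
  refine ⟨⟨hO, hdet⟩, fun T hT _ => ?_⟩
  obtain ⟨d, hd, rfl⟩ := hSigma
  have key : ∀ R : Matrix (Fin n) (Fin n) ℝ,
      (Rᵀ * S).trace = ∑ i, (Vᵀ * Rᵀ * U) i i * d i := by
    intro R
    have : (Rᵀ * S).trace = (Vᵀ * Rᵀ * U * Matrix.diagonal d).trace := by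
      rw [hSVD, ← Matrix.mul_assoc, Matrix.trace_mul_comm]
      simp only [Matrix.mul_assoc]
    rw [this]
    simp [Matrix.trace, Matrix.mul_diagonal]
  unfold frobNorm
  apply Real.sqrt_le_sqrt
  rw [frob_orth_sub _ _ hO, frob_orth_sub _ _ hT, key (U * Vᵀ), key T]
  have h1 : Vᵀ * (U * Vᵀ)ᵀ * U = 1 := by
    rw [Matrix.transpose_mul, Matrix.transpose_transpose, ← Matrix.mul_assoc, hV,
      Matrix.one_mul, hU]
  have hT' : T * Tᵀ = 1 := mul_eq_one_comm.mp hT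
  have hZ : (Vᵀ * Tᵀ * U)ᵀ * (Vᵀ * Tᵀ * U) = 1 := by
    simp only [Matrix.transpose_mul, Matrix.transpose_transpose]
    calc Uᵀ * (T * V) * (Vᵀ * Tᵀ * U) = Uᵀ * (T * (V * Vᵀ) * Tᵀ) * U := by
          simp only [Matrix.mul_assoc]
      _ = 1 := by rw [hV', Matrix.mul_one, hT', Matrix.mul_one, hU]
  have hle : ∑ i, (Vᵀ * Tᵀ * U) i i * d i ≤ ∑ i, (Vᵀ * (U * Vᵀ)ᵀ * U) i i * d i := by
    apply Finset.sum_le_sum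
    intro i _
    rw [h1, Matrix.one_apply_eq]
    exact mul_le_mul_of_nonneg_right (orth_diag_le_one _ hZ i) (hd i)
  linarith
end
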